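/- Let (Y_t)_{t≥0} be a discrete-time stochastic process adapted to a filtration (𝒢_t)_{t≥0}, taking values in ℝ₊. Suppose there exist constants C₀, C₁ > 0 such that for every t ≥ 0, almost surely on the event {Y_t > 0}: (i) E[Y_{t+1} − Y_t | 𝒢_t] ≤ 0; (ii) E[(Y_{t+1} − Y_t)² | 𝒢_t] ≥ C₀; (iii) E[|Y_{t+1} − Y_t|³ | 𝒢_t] ≤ C₁. Then the hitting time ν = inf{t ≥ 1 : Y_t = 0} is almost surely finite. -/

import Mathlib

open MeasureTheory ProbabilityTheory

namespace IDLA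

/-- Cubic lower bound for the exponential function. -/
lemma one_sub_add_sq_sub_abs_cube_le_exp_neg (x : ℝ) :
    1 - x + x ^ 2 / 2 - |x| ^ 3 / 6 ≤ Real.exp (-x) := by
  rcases le_total x 0 with hx | hx
  · have h := Real.quadratic_le_exp_of_nonneg (x := -x) (by linarith)
    have h3 : 0 ≤ |x| ^ 3 := by positivity
    nlinarith
  · rw [abs_of_nonneg hx]
    let f : ℝ → ℝ := fun y => Real.exp y * (1 - y + y ^ 2 / 2 - y ^ 3 / 6)
    have hd : ∀ y, HasDerivAt f (-(Real.exp y * y ^ 3 / 6)) y := by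
      intro y
      have hp : HasDerivAt (fun y : ℝ => 1 - y + y ^ 2 / 2 - y ^ 3 / 6)
          (0 - 1 + (2 * y) / 2 - (3 * y ^ 2) / 6) y := by
        have h2 : HasDerivAt (fun y : ℝ => y ^ 2) (2 * y) y := by
          simpa using hasDerivAt_pow 2 y
        have h3 : HasDerivAt (fun y : ℝ => y ^ 3) (3 * y ^ 2) y := by
          simpa using hasDerivAt_pow 3 y
        exact (((hasDerivAt_const y 1).sub (hasDerivAt_id y)).add (h2.div_const 2)).sub
          (h3.div_const 6)
      refine ((Real.hasDerivAt_exp y).mul hp).congr_deriv ?_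
      ring
    have hanti : AntitoneOn f (Set.Ici 0) := by
      refine antitoneOn_of_deriv_nonpos (convex_Ici 0)
        (fun y _ => (hd y).continuousAt.continuousWithinAt)
        (fun y _ => (hd y).differentiableAt.differentiableWithinAt) fun y hy => ?_
      rw [interior_Ici] at hy
      have hy' : 0 < y := hy
      rw [(hd y).deriv]
      have : 0 ≤ Real.exp y * y ^ 3 / 6 := by positivity
      linarith
    have h := hanti (Set.mem_Ici.2 le_rfl) hx hx
    simp only [f, Real.exp_zero] at h
    rw [Real.exp_neg, ← one_div, le_div_iff₀ (Real.exp_pos x)]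
    linarith

/-- A bound on a conditional expectation, valid where a nonnegative measurable bounded weight
does not vanish, integrates to a bound on the weighted expectation. -/
lemma integral_mul_le_of_condExp_le {Ω : Type*} {m m0 : MeasurableSpace Ω} {μ : Measure Ω}
    [IsFiniteMeasure μ] (hm : m ≤ m0) {g X : Ω → ℝ} {b : ℝ} (hg : StronglyMeasurable[m] g)
    (hg0 : ∀ ω, 0 ≤ g ω) (hg1 : ∀ ω, g ω ≤ 1) (hX : Integrable X μ)
    (h : ∀ᵐ ω ∂μ, g ω ≠ 0 → (μ[X | m]) ω ≤ b) :
    ∫ ω, g ω * X ω ∂μ ≤ b * ∫ ω, g ω ∂μ := by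
  have hgb : ∀ᵐ ω ∂μ, ‖g ω‖ ≤ 1 := ae_of_all _ fun ω => by
    rw [Real.norm_of_nonneg (hg0 ω)]
    exact hg1 ω
  have hgm : AEStronglyMeasurable g μ := (hg.mono hm).aestronglyMeasurable
  have hgi : Integrable g μ := Integrable.of_bound hgm 1 hgb
  have hgX : Integrable (g * X) μ := hX.bdd_mul hgm hgb
  calc ∫ ω, g ω * X ω ∂μ = ∫ ω, (μ[g * X | m]) ω ∂μ := (integral_condExp hm).symm
    _ = ∫ ω, g ω * (μ[X | m]) ω ∂μ :=
        integral_congr_ae (condExp_mul_of_stronglyMeasurable_left hg hgX hX)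
    _ ≤ ∫ ω, b * g ω ∂μ := by
        refine integral_mono_ae (integrable_condExp.bdd_mul hgm hgb) (hgi.const_mul b) ?_
        filter_upwards [h] with ω hω
        by_cases h0 : g ω = 0
        · simp [h0]
        · have := mul_le_mul_of_nonneg_left (hω h0) (hg0 ω)
          linarith
    _ = b * ∫ ω, g ω ∂μ := integral_const_mul _ _

/-- Let `(Y_t)` be a discrete-time, `ℝ₊`-valued process adapted to a
filtration `(𝒢_t)`. If there are constants `C₀, C₁ > 0` such that for every `t`, a.s.
on `{Y_t > 0}`: (i) `E[Y_{t+1} - Y_t | 𝒢_t] ≤ 0`, (ii) `E[(Y_{t+1} - Y_t)² | 𝒢_t] ≥ C₀`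
and (iii) `E[|Y_{t+1} - Y_t|³ | 𝒢_t] ≤ C₁`, then `ν = inf {t ≥ 1 : Y_t = 0}` is almost
surely finite. -/
theorem hitting_time_of_zero_is_finite {Ω : Type} [m0 : MeasurableSpace Ω]
    (μ : Measure Ω) [IsProbabilityMeasure μ] (𝒢 : Filtration ℕ m0) (Y : ℕ → Ω → ℝ)
    (hadapted : Adapted 𝒢 Y) (hnonneg : ∀ t, 0 ≤ᵐ[μ] Y t)
    (hint : ∀ t, Integrable (Y t) μ)
    (hint2 : ∀ t, Integrable (fun ω => (Y (t + 1) ω - Y t ω) ^ 2) μ)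
    (hint3 : ∀ t, Integrable (fun ω => |Y (t + 1) ω - Y t ω| ^ 3) μ)
    (C₀ C₁ : ℝ) (hC₀ : 0 < C₀) (hC₁ : 0 < C₁)
    (h1 : ∀ t, ∀ᵐ ω ∂μ, 0 < Y t ω →
      (μ[fun ω' => Y (t + 1) ω' - Y t ω' | 𝒢 t]) ω ≤ 0)
    (h2 : ∀ t, ∀ᵐ ω ∂μ, 0 < Y t ω →
      C₀ ≤ (μ[fun ω' => (Y (t + 1) ω' - Y t ω') ^ 2 | 𝒢 t]) ω)
    (h3 : ∀ t, ∀ᵐ ω ∂μ, 0 < Y t ω →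
      (μ[fun ω' => |Y (t + 1) ω' - Y t ω'| ^ 3 | 𝒢 t]) ω ≤ C₁) :
    ∀ᵐ ω ∂μ, ∃ t : ℕ, 1 ≤ t ∧ Y t ω = 0 := by
  set l : ℝ := C₀ / C₁ with hl
  have hl0 : 0 < l := by positivity
  have hlC : l * C₁ = C₀ := by rw [hl]; field_simp
  set c : ℝ := l ^ 2 * C₀ / 3 with hc
  have hc0 : 0 < c := by positivity
  let A : ℕ → Set Ω := fun n => {ω | ∀ s, 1 ≤ s → s ≤ n + 1 → 0 < Y s ω}
  have hA_pos : ∀ n, ∀ ω ∈ A n, 0 < Y (n + 1) ω := fun n ω hω => hω _ (by omega) le_rfl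
  have hA_anti : ∀ n, A (n + 1) ⊆ A n := fun n ω hω s h h' => hω s h (by omega)
  have hA_meas : ∀ n, MeasurableSet[𝒢 (n + 1)] (A n) := by
    intro n
    have : A n = ⋂ s, ⋂ (_ : 1 ≤ s), ⋂ (_ : s ≤ n + 1), {ω | 0 < Y s ω} := by
      ext ω
      simp [A]
    rw [this]
    refine MeasurableSet.iInter fun s => MeasurableSet.iInter fun _ =>
      MeasurableSet.iInter fun hs => ?_
    exact 𝒢.mono hs _ (measurableSet_lt measurable_const (hadapted s))
  have hA_meas0 : ∀ n, MeasurableSet (A n) := fun n => 𝒢.le _ _ (hA_meas n)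
  have hY_meas : ∀ t, Measurable (Y t) := fun t => (hadapted t).mono (𝒢.le t) le_rfl
  let V : ℕ → Ω → ℝ := fun n ω => Real.exp (-(l * Y n ω))
  have hV_le : ∀ n ω, 0 ≤ Y n ω → V n ω ≤ 1 := fun n ω h =>
    Real.exp_le_one_iff.2 (neg_nonpos.2 (mul_nonneg hl0.le h))
  have hV_int : ∀ n, Integrable (V n) μ := by
    intro n
    refine Integrable.of_bound
      ((hY_meas n).const_mul l).neg.exp.aestronglyMeasurable 1 ?_
    filter_upwards [hnonneg n] with ω hω
    rw [Real.norm_of_nonneg (Real.exp_pos _).le]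
    exact hV_le n ω hω
  have hD_int : ∀ n, Integrable (fun ω => Y (n + 1) ω - Y n ω) μ := fun n =>
    (hint _).sub (hint _)
  let K : ℝ := ∫ ω in A 0, Y 1 ω ∂μ
  have hY_bound : ∀ n, ∫ ω in A n, Y (n + 1) ω ∂μ ≤ K := by
    intro n
    induction n with
    | zero => exact le_rfl
    | succ n ih =>
      refine le_trans ?_ ih
      have hs : ∫ ω in A (n + 1), Y (n + 2) ω ∂μ ≤ ∫ ω in A n, Y (n + 2) ω ∂μ :=
        setIntegral_mono_set (hint _).integrableOn (ae_restrict_of_ae (hnonneg _))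
          (hA_anti n).eventuallyLE
      have hD := integral_mul_le_of_condExp_le (μ := μ) (𝒢.le (n + 1))
        (g := (A n).indicator fun _ => 1) (b := 0)
        (stronglyMeasurable_const.indicator (hA_meas n))
        (fun ω => Set.indicator_nonneg (fun _ _ => zero_le_one) ω)
        (fun ω => Set.indicator_le_self' (fun _ _ => zero_le_one) ω) (hD_int (n + 1)) (by
          filter_upwards [h1 (n + 1)] with ω hω h0
          exact hω (hA_pos n ω (Set.mem_of_indicator_ne_zero h0)))
      have he : ∀ ω, (A n).indicator (fun _ => (1 : ℝ)) ω * (Y (n + 1 + 1) ω - Y (n + 1) ω) =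
          (A n).indicator (fun ω => Y (n + 1 + 1) ω - Y (n + 1) ω) ω := by
        intro ω
        by_cases h : ω ∈ A n <;> simp [h]
      simp only [he] at hD
      rw [integral_indicator (hA_meas0 n),
        integral_sub (hint _).integrableOn (hint _).integrableOn] at hD
      linarith
  let v : ℕ → ℝ := fun n => ∫ ω in A n, V (n + 1) ω ∂μ
  have hv0 : ∀ n, 0 ≤ v n := fun n =>
    setIntegral_nonneg (hA_meas0 n) fun ω _ => (Real.exp_pos _).le
  let w : ℕ → ℝ := fun n => ∫ ω in A n, (1 - V (n + 1) ω) ∂μ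
  have hw0 : ∀ n, 0 ≤ w n := fun n =>
    setIntegral_nonneg (hA_meas0 n) fun ω hω => sub_nonneg.2 (hV_le _ ω (hA_pos n ω hω).le)
  have hstep : ∀ n, w (n + 1) + c * v n ≤ w n := by
    intro n
    have hs : w (n + 1) ≤ ∫ ω in A n, (1 - V (n + 2) ω) ∂μ := by
      refine setIntegral_mono_set ((integrable_const 1).sub (hV_int _)).integrableOn
        (ae_restrict_of_ae ?_) (hA_anti n).eventuallyLE
      filter_upwards [hnonneg (n + 2)] with ω hω
      exact sub_nonneg.2 (hV_le _ ω hω)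
    let g : Ω → ℝ := (A n).indicator (V (n + 1))
    have hg : StronglyMeasurable[𝒢 (n + 1)] g := by
      refine StronglyMeasurable.indicator ?_ (hA_meas n)
      exact (((hadapted (n + 1)).const_mul l).neg.exp).stronglyMeasurable
    have hg0 : ∀ ω, 0 ≤ g ω := fun ω =>
      Set.indicator_nonneg (fun _ _ => (Real.exp_pos _).le) ω
    have hg1 : ∀ ω, g ω ≤ 1 := fun ω =>
      Set.indicator_le' (fun ω hω => hV_le _ ω (hA_pos n ω hω).le) (fun _ _ => zero_le_one) ω
    have hgpos : ∀ ω, g ω ≠ 0 → 0 < Y (n + 1) ω := fun ω h0 =>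
      hA_pos n ω (Set.mem_of_indicator_ne_zero h0)
    have hgb : ∀ᵐ ω ∂μ, ‖g ω‖ ≤ 1 := ae_of_all _ fun ω => by
      rw [Real.norm_of_nonneg (hg0 ω)]
      exact hg1 ω
    have hgm : AEStronglyMeasurable g μ := (hg.mono (𝒢.le _)).aestronglyMeasurable
    have i1 := integral_mul_le_of_condExp_le (μ := μ) (𝒢.le (n + 1)) hg hg0 hg1
      (hD_int (n + 1)) (b := 0) (by
        filter_upwards [h1 (n + 1)] with ω hω h0 using hω (hgpos ω h0))
    have i2 := integral_mul_le_of_condExp_le (μ := μ) (𝒢.le (n + 1)) hg hg0 hg1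
      (hint2 (n + 1)).neg (b := -C₀) (by
        filter_upwards [h2 (n + 1), condExp_neg (μ := μ)
          (fun ω => (Y (n + 1 + 1) ω - Y (n + 1) ω) ^ 2) (𝒢 (n + 1))] with ω hω hneg h0
        rw [hneg]
        exact neg_le_neg (hω (hgpos ω h0)))
    have i3 := integral_mul_le_of_condExp_le (μ := μ) (𝒢.le (n + 1)) hg hg0 hg1
      (hint3 (n + 1)) (b := C₁) (by
        filter_upwards [h3 (n + 1)] with ω hω h0 using hω (hgpos ω h0))
    have hgv : ∫ ω, g ω ∂μ = v n := integral_indicator (hA_meas0 n)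
    rw [hgv] at i1 i2 i3
    simp only [Pi.neg_apply, mul_neg, integral_neg] at i2
    have j1 : Integrable (fun ω => g ω * (Y (n + 1 + 1) ω - Y (n + 1) ω)) μ :=
      (hD_int (n + 1)).bdd_mul hgm hgb
    have j2 : Integrable (fun ω => g ω * (Y (n + 1 + 1) ω - Y (n + 1) ω) ^ 2) μ :=
      (hint2 (n + 1)).bdd_mul hgm hgb
    have j3 : Integrable (fun ω => g ω * |Y (n + 1 + 1) ω - Y (n + 1) ω| ^ 3) μ :=
      (hint3 (n + 1)).bdd_mul hgm hgb
    have key : ∫ ω in A n, (1 - V (n + 2) ω) ∂μ ≤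
        ∫ ω, ((A n).indicator (fun ω => 1 - V (n + 1) ω) ω +
          (l * (g ω * (Y (n + 1 + 1) ω - Y (n + 1) ω)) -
            l ^ 2 / 2 * (g ω * (Y (n + 1 + 1) ω - Y (n + 1) ω) ^ 2) +
            l ^ 3 / 6 * (g ω * |Y (n + 1 + 1) ω - Y (n + 1) ω| ^ 3))) ∂μ := by
      rw [← integral_indicator (hA_meas0 n)]
      refine integral_mono
        (((integrable_const 1).sub (hV_int _)).indicator (hA_meas0 n))
        ((((integrable_const 1).sub (hV_int _)).indicator (hA_meas0 n)).add
          (((j1.const_mul _).sub (j2.const_mul _)).add (j3.const_mul _))) fun ω => ?_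
      by_cases h : ω ∈ A n
      · simp only [g, Set.indicator_of_mem h]
        have hexp := one_sub_add_sq_sub_abs_cube_le_exp_neg
          (l * (Y (n + 1 + 1) ω - Y (n + 1) ω))
        have hmul : V (n + 2) ω =
            V (n + 1) ω * Real.exp (-(l * (Y (n + 1 + 1) ω - Y (n + 1) ω))) := by
          simp only [V]
          rw [← Real.exp_add]
          congr 1
          ring
        rw [abs_mul, abs_of_pos hl0] at hexp
        have := mul_le_mul_of_nonneg_left hexp (Real.exp_pos (-(l * Y (n + 1) ω))).le
        rw [hmul]
        simp only [V] at this ⊢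
        linarith
      · simp [g, h]
    have k0 : Integrable ((A n).indicator fun ω => 1 - V (n + 1) ω) μ :=
      ((integrable_const 1).sub (hV_int _)).indicator (hA_meas0 n)
    have k12 : Integrable (fun ω => l * (g ω * (Y (n + 1 + 1) ω - Y (n + 1) ω)) -
        l ^ 2 / 2 * (g ω * (Y (n + 1 + 1) ω - Y (n + 1) ω) ^ 2)) μ :=
      (j1.const_mul l).sub (j2.const_mul (l ^ 2 / 2))
    have k3 := j3.const_mul (l ^ 3 / 6)
    have k123 : Integrable (fun ω => l * (g ω * (Y (n + 1 + 1) ω - Y (n + 1) ω)) -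
        l ^ 2 / 2 * (g ω * (Y (n + 1 + 1) ω - Y (n + 1) ω) ^ 2) +
        l ^ 3 / 6 * (g ω * |Y (n + 1 + 1) ω - Y (n + 1) ω| ^ 3)) μ := k12.add k3
    rw [integral_add k0 k123, integral_add k12 k3,
      integral_sub (j1.const_mul l) (j2.const_mul (l ^ 2 / 2)), integral_const_mul,
      integral_const_mul, integral_const_mul, integral_indicator (hA_meas0 n)] at key
    have e1 := mul_le_mul_of_nonneg_left i1 hl0.le
    have e2 := mul_le_mul_of_nonneg_left i2 (by positivity : 0 ≤ l ^ 2 / 2)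
    have e3 := mul_le_mul_of_nonneg_left i3 (by positivity : 0 ≤ l ^ 3 / 6)
    have e4 : l ^ 3 / 6 * (C₁ * v n) = l ^ 2 * C₀ / 6 * v n := by
      rw [← hlC]; ring
    rw [e4] at e3
    simp only [hc, w] at hs ⊢
    linarith
  have hv_sum : Summable v := by
    refine summable_of_sum_range_le (c := w 0 / c) hv0 fun n => ?_
    have : ∀ n, w n + c * ∑ i ∈ Finset.range n, v i ≤ w 0 := by
      intro n
      induction n with
      | zero => simp
      | succ n ih =>
        rw [Finset.sum_range_succ]
        linarith [hstep n]
    rw [le_div_iff₀ hc0]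
    linarith [this n, hw0 n]
  let p : ℝ := μ.real (⋂ n, A n)
  have hp : ∀ M : ℝ, 0 < M → ∀ n, p ≤ Real.exp (l * M) * v n + K / M := by
    intro M hM n
    calc p ≤ μ.real (A n) := measureReal_mono (Set.iInter_subset _ n)
      _ = ∫ ω in A n, (1 : ℝ) ∂μ := by simp
      _ ≤ ∫ ω in A n, (Real.exp (l * M) * V (n + 1) ω + Y (n + 1) ω / M) ∂μ := by
          refine setIntegral_mono_on (integrable_const 1).integrableOn
            (((hV_int _).const_mul _).add ((hint _).div_const _)).integrableOn (hA_meas0 n)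
            fun ω hω => ?_
          have hy := hA_pos n ω hω
          simp only [V]
          rw [← Real.exp_add]
          rcases le_total (Y (n + 1) ω) M with h | h
          · have h1 : 1 ≤ Real.exp (l * M + -(l * Y (n + 1) ω)) :=
              Real.one_le_exp (by nlinarith)
            have h2 : 0 ≤ Y (n + 1) ω / M := by positivity
            linarith
          · have h1 : 1 ≤ Y (n + 1) ω / M := (one_le_div hM).2 h
            linarith [Real.exp_pos (l * M + -(l * Y (n + 1) ω))]
      _ = Real.exp (l * M) * v n + (∫ ω in A n, Y (n + 1) ω ∂μ) / M := by
          rw [integral_add ((hV_int _).const_mul _).integrableOn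
            ((hint _).div_const _).integrableOn, integral_const_mul, integral_div]
      _ ≤ Real.exp (l * M) * v n + K / M := by
          gcongr
          exact hY_bound n
  have hpM : ∀ M : ℝ, 0 < M → p ≤ K / M := by
    intro M hM
    have ht : Filter.Tendsto (fun n => Real.exp (l * M) * v n + K / M) Filter.atTop
        (nhds (Real.exp (l * M) * 0 + K / M)) :=
      (hv_sum.tendsto_atTop_zero.const_mul _).add_const _
    simpa using ge_of_tendsto' ht (hp M hM)
  have hp0 : p ≤ 0 := by
    have ht : Filter.Tendsto (fun M : ℝ => K / M) Filter.atTop (nhds 0) :=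
      tendsto_const_nhds.div_atTop Filter.tendsto_id
    refine ge_of_tendsto ht ?_
    filter_upwards [Filter.eventually_gt_atTop 0] with M hM using hpM M hM
  have hnull : μ (⋂ n, A n) = 0 :=
    (measureReal_eq_zero_iff).1 (le_antisymm hp0 measureReal_nonneg)
  filter_upwards [measure_eq_zero_iff_ae_notMem.1 hnull, ae_all_iff.2 hnonneg] with ω hω hpos
  by_contra! hne
  exact hω (Set.mem_iInter.2 fun n s hs _ => lt_of_le_of_ne (hpos s) (hne s hs).symm)

end IDLA
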